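/- (i) Every sequence of mm₁-spaces of finite size that is Cauchy with respect to the L²-transportation distance D₂ converges in D₂ to some mm₁-space of finite size. (ii) There exists a sequence of mm₁-spaces of finite size that is Cauchy with respect to the L²-distortion distance Δ₂ but admits no mm₁-space as a Δ₂-limit. -/

import Mathlib

open MeasureTheory Filter Set Topology ENNReal
open scoped Classical

noncomputable section

/-- A coupling of two measures. -/
def IsCoupling {α β : Type*} [MeasurableSpace α] [MeasurableSpace β]
    (q : Measure (α × β)) (μ : Measure α) (ν : Measure β) : Prop :=
  Measure.map Prod.fst q = μ ∧ Measure.map Prod.snd q = ν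

/-- Membership in the Wasserstein space `P₂`. -/
def MemP2 {α : Type*} [MetricSpace α] [MeasurableSpace α] (μ : Measure α) : Prop :=
  IsProbabilityMeasure μ ∧ ∃ x₀ : α, ∫⁻ x, edist x x₀ ^ 2 ∂μ < ∞

/-- The squared Kantorovich–Wasserstein distance. -/
def Wsq {α : Type*} [MetricSpace α] [MeasurableSpace α] (μ ν : Measure α) : ℝ≥0∞ :=
  ⨅ (q : Measure (α × α)) (_ : IsCoupling q μ ν), ∫⁻ p, edist p.1 p.2 ^ 2 ∂q

/-- The Kantorovich–Wasserstein distance `W₂`. -/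
def W2 {α : Type*} [MetricSpace α] [MeasurableSpace α] (μ ν : Measure α) : ℝ≥0∞ :=
  Wsq μ ν ^ (1/2 : ℝ)

/-- A `W₂`-geodesic parametrized by `[0,1]`. -/
def IsW2Geodesic {α : Type*} [MetricSpace α] [MeasurableSpace α] (μ : ℝ → Measure α) : Prop :=
  ∀ s ∈ Icc (0:ℝ) 1, ∀ t ∈ Icc (0:ℝ) 1,
    W2 (μ s) (μ t) = ENNReal.ofReal |s - t| * W2 (μ 0) (μ 1)

/-- Integrand of the Boltzmann entropy. -/
def entFun {α : Type*} [MeasurableSpace α] (μ m : Measure α) (x : α) : ℝ :=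
  (μ.rnDeriv m x).toReal * Real.log (μ.rnDeriv m x).toReal

/-- Boltzmann entropy `Ent(μ|m)`. -/
def Ent {α : Type*} [MeasurableSpace α] (μ m : Measure α) : EReal :=
  if μ ≪ m ∧ Integrable (fun x => max (entFun μ m x) 0) m then
    ((∫ x, max (entFun μ m x) 0 ∂m : ℝ) : EReal)
      - ((∫⁻ x, ENNReal.ofReal (-(entFun μ m x)) ∂m : ℝ≥0∞) : EReal)
  else ⊤

/-- The CD(K,∞) convexity inequality along some geodesic from `μ₀` to `μ₁`. -/
def CDinftyFor {α : Type*} [MetricSpace α] [MeasurableSpace α]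
    (K : ℝ) (m μ₀ μ₁ : Measure α) : Prop :=
  ∃ μ : ℝ → Measure α, μ 0 = μ₀ ∧ μ 1 = μ₁ ∧ IsW2Geodesic μ ∧
    ∀ t ∈ Icc (0:ℝ) 1,
      Ent (μ t) m ≤ ((1 - t : ℝ) : EReal) * Ent μ₀ m + ((t : ℝ) : EReal) * Ent μ₁ m
        - ((K/2 * (t * (1-t)) : ℝ) : EReal) * ((Wsq μ₀ μ₁ : ℝ≥0∞) : EReal)

/-- The curvature-dimension condition CD(K,∞). -/
def CDinfty {α : Type*} [MetricSpace α] [MeasurableSpace α] (K : ℝ) (m : Measure α) : Prop :=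
  ∀ μ₀ μ₁ : Measure α, MemP2 μ₀ → MemP2 μ₁ → CDinftyFor K m μ₀ μ₁

/-- Distortion coefficients `τ^{(t)}_{K,N}(θ)`. -/
def tauCoef (K N t θ : ℝ) : ℝ≥0∞ :=
  if 0 < K then
    if Real.pi * Real.sqrt ((N-1)/K) ≤ θ then ∞
    else ENNReal.ofReal (t ^ (1/N) *
      (Real.sin (Real.sqrt (K/(N-1)) * (t * θ)) / Real.sin (Real.sqrt (K/(N-1)) * θ)) ^ ((N-1)/N))
  else if K = 0 then ENNReal.ofReal t
  else ENNReal.ofReal (t ^ (1/N) *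
      (Real.sinh (Real.sqrt (-K/(N-1)) * (t * θ)) / Real.sinh (Real.sqrt (-K/(N-1)) * θ)) ^ ((N-1)/N))

/-- The CD(K,N) inequality along some geodesic/optimal coupling from `μ₀` to `μ₁`,
with distortion coefficients `coef`. -/
def CDForWith {α : Type*} [MetricSpace α] [MeasurableSpace α]
    (coef : ℝ → ℝ → ℝ≥0∞) (N : ℝ) (m μ₀ μ₁ : Measure α) : Prop :=
  ∃ (μ : ℝ → Measure α) (q : Measure (α × α)),
    μ 0 = μ₀ ∧ μ 1 = μ₁ ∧ IsW2Geodesic μ ∧ (∀ t ∈ Icc (0:ℝ) 1, μ t ≪ m) ∧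
    IsCoupling q μ₀ μ₁ ∧ (∫⁻ p, edist p.1 p.2 ^ 2 ∂q) = Wsq μ₀ μ₁ ∧
    ∀ t ∈ Icc (0:ℝ) 1,
      ∫⁻ x, ((μ t).rnDeriv m x) ^ (1 - 1/N : ℝ) ∂m ≥
      ∫⁻ p, coef (1-t) (dist p.1 p.2) * (μ₀.rnDeriv m p.1) ^ (-(1/N) : ℝ)
            + coef t (dist p.1 p.2) * (μ₁.rnDeriv m p.2) ^ (-(1/N) : ℝ) ∂q

def CDFor {α : Type*} [MetricSpace α] [MeasurableSpace α]
    (K N : ℝ) (m μ₀ μ₁ : Measure α) : Prop :=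
  CDForWith (fun t θ => tauCoef K N t θ) N m μ₀ μ₁

/-- The curvature-dimension condition CD(K,N). -/
def CD {α : Type*} [MetricSpace α] [MeasurableSpace α] (K N : ℝ) (m : Measure α) : Prop :=
  ∀ μ₀ μ₁ : Measure α, MemP2 μ₀ → MemP2 μ₁ → μ₀ ≪ m → μ₁ ≪ m → CDFor K N m μ₀ μ₁

/-- The support of a measure on a topological space. -/
def mmSupp {α : Type*} [TopologicalSpace α] [MeasurableSpace α] (μ : Measure α) : Set α :=
  {x | ∀ U ∈ nhds x, 0 < μ U}


/-- A normalized metric measure space (mm₁-space): a complete separable metric space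
equipped with a Borel probability measure. -/
structure MM1 : Type 1 where
  carrier : Type
  met : MetricSpace carrier
  cpl : CompleteSpace carrier
  sep : TopologicalSpace.SeparableSpace carrier
  mea : MeasurableSpace carrier
  bor : BorelSpace carrier
  m : MeasureTheory.Measure carrier
  prob : MeasureTheory.IsProbabilityMeasure m

attribute [instance] MM1.met MM1.cpl MM1.sep MM1.mea MM1.bor MM1.prob

/-- An mm₁-space has finite size iff `∫∫ d(x,y)² dm dm < ∞`. -/
def FiniteSize (Y : MM1) : Prop :=
  (∫⁻ x, ∫⁻ y, edist x y ^ 2 ∂Y.m ∂Y.m) < ∞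

/-- A coupling of the metrics: a complete separable metric on the disjoint union
restricting to the given metrics on the two pieces. -/
def IsMetricCoupling {α β : Type*} [MetricSpace α] [MetricSpace β]
    (D : α ⊕ β → α ⊕ β → ℝ) : Prop :=
  (∀ p, D p p = 0) ∧ (∀ p q, D p q = D q p) ∧ (∀ p q r, D p r ≤ D p q + D q r) ∧
  (∀ p q, D p q = 0 → p = q) ∧
  (∀ x y : α, D (Sum.inl x) (Sum.inl y) = dist x y) ∧
  (∀ x y : β, D (Sum.inr x) (Sum.inr y) = dist x y) ∧
  (∀ u : ℕ → α ⊕ β, (∀ ε : ℝ, 0 < ε → ∃ N, ∀ j ≥ N, ∀ k ≥ N, D (u j) (u k) < ε) →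
    ∃ p, Filter.Tendsto (fun n => D (u n) p) Filter.atTop (nhds 0)) ∧
  (∃ S : Set (α ⊕ β), S.Countable ∧ ∀ p : α ⊕ β, ∀ ε : ℝ, 0 < ε → ∃ s ∈ S, D p s < ε)

/-- The L²-transportation distance between mm₁-spaces. -/
def D2 (Y₀ Y₁ : MM1) : ℝ≥0∞ :=
  ⨅ (q : Measure (Y₀.carrier × Y₁.carrier)) (_ : IsCoupling q Y₀.m Y₁.m)
    (D : Y₀.carrier ⊕ Y₁.carrier → Y₀.carrier ⊕ Y₁.carrier → ℝ) (_ : IsMetricCoupling D),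
    (∫⁻ p, ENNReal.ofReal (D (Sum.inl p.1) (Sum.inr p.2)) ^ 2 ∂q) ^ (1/2 : ℝ)

/-- The L²-distortion distance between mm₁-spaces. -/
def Delta2 (Y₀ Y₁ : MM1) : ℝ≥0∞ :=
  ⨅ (q : Measure (Y₀.carrier × Y₁.carrier)) (_ : IsCoupling q Y₀.m Y₁.m),
    (∫⁻ p, ∫⁻ p', ENNReal.ofReal |dist p.1 p'.1 - dist p.2 p'.2| ^ 2 ∂q ∂q) ^ (1/2 : ℝ)

/-- Cauchy with respect to an `ℝ≥0∞`-valued distance on mm₁-spaces. -/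
def IsCauchySeqWith (dst : MM1 → MM1 → ℝ≥0∞) (Y : ℕ → MM1) : Prop :=
  ∀ ε : ℝ≥0∞, 0 < ε → ∃ N, ∀ j ≥ N, ∀ k ≥ N, dst (Y j) (Y k) < ε


/-! ### Part (ii): the sequence of discrete spaces -/

/-- `n+1` points at mutual distance one. -/
structure DPt (n : ℕ) where
  val : Fin (n + 1)

instance (n : ℕ) : MetricSpace (DPt n) where
  dist x y := if x = y then 0 else 1
  dist_self x := by simp
  dist_comm x y := by simp [eq_comm]
  dist_triangle x y z := by
    by_cases h1 : x = y <;> by_cases h2 : y = z <;> by_cases h3 : x = z <;> simp_all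
  eq_of_dist_eq_zero {x y} h := by
    by_contra hne
    simp [hne] at h

theorem DPt.dist_def {n : ℕ} (x y : DPt n) : dist x y = if x = y then 0 else 1 := rfl

def DPt.equiv (n : ℕ) : DPt n ≃ Fin (n + 1) := ⟨DPt.val, DPt.mk, fun _ => rfl, fun _ => rfl⟩

instance (n : ℕ) : Fintype (DPt n) := Fintype.ofEquiv _ (DPt.equiv n).symm
instance (n : ℕ) : Nonempty (DPt n) := ⟨⟨0⟩⟩

theorem DPt.card (n : ℕ) : Fintype.card (DPt n) = n + 1 := by
  rw [Fintype.card_congr (DPt.equiv n)]; simp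

instance (n : ℕ) : MeasurableSpace (DPt n) := ⊤
instance (n : ℕ) : DiscreteMeasurableSpace (DPt n) := ⟨fun _ => trivial⟩
instance (n : ℕ) : BorelSpace (DPt n) := by
  refine ⟨?_⟩
  symm
  exact borel_eq_top_of_discrete

def DPt.mu (n : ℕ) : Measure (DPt n) := (PMF.uniformOfFintype (DPt n)).toMeasure
instance (n : ℕ) : IsProbabilityMeasure (DPt.mu n) := by unfold DPt.mu; infer_instance

theorem DPt.mu_singleton (n : ℕ) (x : DPt n) : DPt.mu n {x} = ((n : ℝ≥0∞) + 1)⁻¹ := by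
  unfold DPt.mu
  rw [PMF.toMeasure_apply_singleton _ _ (MeasurableSet.singleton x)]
  simp [DPt.card]

/-- The discrete mm₁-space with `n+1` points. -/
def DSp (n : ℕ) : MM1 where
  carrier := DPt n
  met := inferInstance
  cpl := inferInstance
  sep := inferInstance
  mea := inferInstance
  bor := inferInstance
  m := DPt.mu n
  prob := inferInstance

theorem DSp_finite (n : ℕ) : FiniteSize (DSp n) := by
  unfold FiniteSize
  calc (∫⁻ x, ∫⁻ y, edist x y ^ 2 ∂(DSp n).m ∂(DSp n).m)
      ≤ ∫⁻ _x, ∫⁻ _y, 1 ∂(DSp n).m ∂(DSp n).m := by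
        refine lintegral_mono fun x => lintegral_mono fun y => ?_
        have : edist x y ≤ 1 := by
          rw [edist_dist]
          have : dist x y ≤ 1 := by
            change (if x = y then (0:ℝ) else 1) ≤ 1
            split_ifs <;> norm_num
          simpa using ENNReal.ofReal_le_ofReal this
        exact pow_le_one₀ (by simp) this
    _ = 1 := by simp
    _ < ∞ := by simp

theorem lint_eq_fst {α β : Type*} [MeasurableSpace α] [MeasurableSpace β]
    [MeasurableSingletonClass α]
    {q : Measure (α × β)} {μ : Measure α} (h : Measure.map Prod.fst q = μ) (a : α) :
    ∫⁻ p', (if a = p'.1 then (1 : ℝ≥0∞) else 0) ∂q = μ {a} := by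
  rw [← h, Measure.map_apply measurable_fst (MeasurableSet.singleton a),
    ← lintegral_indicator_one (measurable_fst (MeasurableSet.singleton a))]
  refine lintegral_congr fun p => ?_
  simp [indicator, eq_comm]

theorem lint_eq_snd {α β : Type*} [MeasurableSpace α] [MeasurableSpace β]
    [MeasurableSingletonClass β]
    {q : Measure (α × β)} {μ : Measure β} (h : Measure.map Prod.snd q = μ) (a : β) :
    ∫⁻ p', (if a = p'.2 then (1 : ℝ≥0∞) else 0) ∂q = μ {a} := by
  rw [← h, Measure.map_apply measurable_snd (MeasurableSet.singleton a),
    ← lintegral_indicator_one (measurable_snd (MeasurableSet.singleton a))]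
  refine lintegral_congr fun p => ?_
  simp [indicator, eq_comm]

theorem meas_eq_fst {α β : Type*} [MeasurableSpace α] [MeasurableSpace β]
    [MeasurableSingletonClass α] (a : α) :
    Measurable (fun p : α × β => (if a = p.1 then (1 : ℝ≥0∞) else 0)) := by
  refine Measurable.ite ?_ measurable_const measurable_const
  have : {p : α × β | a = p.1} = Prod.fst ⁻¹' {a} := by ext; simp [eq_comm]
  rw [this]
  exact measurable_fst (MeasurableSet.singleton a)

theorem Delta2_DSp (j k : ℕ) :
    Delta2 (DSp j) (DSp k) ≤ (((j : ℝ≥0∞) + 1)⁻¹ + ((k : ℝ≥0∞) + 1)⁻¹) ^ (1/2 : ℝ) := by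
  unfold Delta2
  have hc : IsCoupling ((DPt.mu j).prod (DPt.mu k)) (DPt.mu j) (DPt.mu k) := by
    constructor <;> simp
  refine iInf₂_le_of_le ((DPt.mu j).prod (DPt.mu k)) hc ?_
  refine ENNReal.rpow_le_rpow ?_ (by norm_num)
  change ∫⁻ p : DPt j × DPt k, ∫⁻ p' : DPt j × DPt k, _ ∂((DPt.mu j).prod (DPt.mu k)) ∂((DPt.mu j).prod (DPt.mu k)) ≤ _
  calc _ ≤ ∫⁻ p : DPt j × DPt k, ∫⁻ p' : DPt j × DPt k,
            ((if p.1 = p'.1 then 1 else 0) + (if p.2 = p'.2 then 1 else 0))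
            ∂((DPt.mu j).prod (DPt.mu k)) ∂((DPt.mu j).prod (DPt.mu k)) := by
        refine lintegral_mono fun p => lintegral_mono fun p' => ?_
        change ENNReal.ofReal |dist p.1 p'.1 - dist p.2 p'.2| ^ 2 ≤ _
        rw [DPt.dist_def, DPt.dist_def]
        split_ifs <;> simp
    _ = ∫⁻ p : DPt j × DPt k, (((j : ℝ≥0∞) + 1)⁻¹ + ((k : ℝ≥0∞) + 1)⁻¹) ∂((DPt.mu j).prod (DPt.mu k)) := by
        refine lintegral_congr fun p => ?_
        rw [lintegral_add_left (meas_eq_fst p.1), lint_eq_fst hc.1, lint_eq_snd hc.2,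
          DPt.mu_singleton, DPt.mu_singleton]
    _ = _ := by simp

theorem exists_ball_pos (Z : MM1) : ∃ z : Z.carrier, Z.m (Metric.ball z (1/4)) ≠ 0 := by
  by_contra h
  push Not at h
  obtain ⟨s, hs, hd⟩ := TopologicalSpace.exists_countable_dense Z.carrier
  have hu : (univ : Set Z.carrier) ⊆ ⋃ z ∈ s, Metric.ball z (1/4) := by
    intro x _
    obtain ⟨z, hz, hxz⟩ := hd.exists_dist_lt x (show (0:ℝ) < 1/4 by norm_num)
    exact mem_iUnion₂.2 ⟨z, hz, hxz⟩
  have h0 : Z.m (⋃ z ∈ s, Metric.ball z (1/4)) = 0 := (measure_biUnion_null_iff hs).2 fun z _ => h z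
  have : Z.m univ = 0 := measure_mono_null hu h0
  simp at this

theorem Delta2_DSp_lower (Z : MM1) (z : Z.carrier) (n : ℕ) :
    Z.m (Metric.ball z (1/4)) ^ 2 * (1/4) ≤ Delta2 (DSp n) Z ^ (2:ℝ) + ((n : ℝ≥0∞) + 1)⁻¹ := by
  rw [← tsub_le_iff_right, ← ENNReal.rpow_inv_le_iff (by norm_num)]
  unfold Delta2
  refine le_iInf₂ fun q hq => ?_
  rw [ENNReal.rpow_inv_le_iff (by norm_num), ← ENNReal.rpow_mul]
  norm_num1
  rw [ENNReal.rpow_one, tsub_le_iff_right]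
  set B := Metric.ball z (1/4) with hB
  have hBm : MeasurableSet B := measurableSet_ball
  have hqB : q (Prod.snd ⁻¹' B) = Z.m B := by
    rw [← hq.2, Measure.map_apply measurable_snd hBm]
  have hBm' : MeasurableSet (Prod.snd ⁻¹' B : Set ((DSp n).carrier × Z.carrier)) := measurable_snd hBm
  have : IsProbabilityMeasure q := by
    refine ⟨?_⟩
    have : Measure.map Prod.fst q univ = 1 := by rw [hq.1]; simp
    rwa [Measure.map_apply measurable_fst MeasurableSet.univ] at this
  let f : (DSp n).carrier × Z.carrier → ℝ≥0∞ := indicator (Prod.snd ⁻¹' B) 1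
  have hf : ∫⁻ p, f p ∂q = Z.m B := by
    rw [lintegral_indicator_one hBm', hqB]
  have hfm : Measurable f := measurable_one.indicator hBm'
  have key : ∀ p p' : (DSp n).carrier × Z.carrier,
      f p * 4⁻¹ * f p' ≤ (if p.1 = p'.1 then 1 else 0)
        + ENNReal.ofReal |dist p.1 p'.1 - dist p.2 p'.2| ^ 2 := by
    intro p p'
    by_cases hp : p.2 ∈ B
    swap
    · simp [f, hp]
    by_cases hp' : p'.2 ∈ B
    swap
    · simp [f, hp']
    simp only [f, mem_preimage, hp, hp', indicator_of_mem, Pi.one_apply, mul_one, one_mul]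
    by_cases he : p.1 = p'.1
    · simp only [he, if_true]
      refine le_trans ?_ le_self_add
      norm_num
    · simp only [he, if_false, zero_add]
      have h1 : dist p.1 p'.1 = 1 := by
        change (if p.1 = p'.1 then (0:ℝ) else 1) = 1
        simp [he]
      rw [h1]
      have h2 : dist p.2 p'.2 ≤ 1/2 := by
        have a1 : dist p.2 z < 1/4 := hp
        have a2 : dist p'.2 z < 1/4 := hp'
        have := dist_triangle_right p.2 p'.2 z
        linarith
      have h3 : (1/2 : ℝ) ≤ |1 - dist p.2 p'.2| := le_trans (by linarith) (le_abs_self _)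
      rw [← ENNReal.ofReal_pow (abs_nonneg _)]
      calc (4⁻¹ : ℝ≥0∞) = ENNReal.ofReal (4⁻¹) := by
            rw [ENNReal.ofReal_inv_of_pos (by norm_num)]; norm_num
        _ ≤ _ := ENNReal.ofReal_le_ofReal (by nlinarith)
  calc Z.m B ^ 2 * (1/4) = ∫⁻ p, ∫⁻ p', f p * 4⁻¹ * f p' ∂q ∂q := by
        simp_rw [lintegral_const_mul _ hfm, hf]
        rw [lintegral_mul_const _ (by fun_prop), lintegral_mul_const _ hfm, hf, one_div]
        ring
    _ ≤ ∫⁻ p, ∫⁻ p', ((if p.1 = p'.1 then 1 else 0)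
        + ENNReal.ofReal |dist p.1 p'.1 - dist p.2 p'.2| ^ 2) ∂q ∂q :=
        lintegral_mono fun p => lintegral_mono fun p' => key p p'
    _ = ∫⁻ p, (((n : ℝ≥0∞) + 1)⁻¹ +
          ∫⁻ p', ENNReal.ofReal |dist p.1 p'.1 - dist p.2 p'.2| ^ 2 ∂q) ∂q := by
        refine lintegral_congr fun p => ?_
        rw [lintegral_add_left (meas_eq_fst p.1), lint_eq_fst hq.1]
        congr 1
        exact DPt.mu_singleton n p.1
    _ = _ := by
        rw [lintegral_add_left measurable_const, lintegral_const]
        simp [add_comm]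

theorem tendsto_inv_succ : Tendsto (fun n : ℕ => ((n : ℝ≥0∞) + 1)⁻¹) atTop (𝓝 0) := by
  have h := (tendsto_add_atTop_iff_nat 1).2 ENNReal.tendsto_inv_nat_nhds_zero
  simpa using h

theorem part_two : ∃ Y : ℕ → MM1, (∀ n, FiniteSize (Y n)) ∧ IsCauchySeqWith Delta2 Y ∧
      ¬ ∃ Z : MM1, Filter.Tendsto (fun n => Delta2 (Y n) Z) Filter.atTop (nhds 0) := by
  refine ⟨DSp, DSp_finite, ?_, ?_⟩
  · intro ε hε
    have h2 : (0 : ℝ≥0∞) < ε ^ (2:ℝ) / 2 := by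
      refine ENNReal.div_pos ?_ (by norm_num)
      exact (ENNReal.rpow_pos_of_nonneg hε (by norm_num)).ne'
    obtain ⟨N, hN⟩ := eventually_atTop.1 (tendsto_inv_succ.eventually (gt_mem_nhds h2))
    refine ⟨N, fun j hj k hk => (Delta2_DSp j k).trans_lt ?_⟩
    rw [one_div, ENNReal.rpow_inv_lt_iff (by norm_num)]
    calc _ < ε ^ (2:ℝ) / 2 + ε ^ (2:ℝ) / 2 := ENNReal.add_lt_add (hN j hj) (hN k hk)
      _ = _ := ENNReal.add_halves _
  · rintro ⟨Z, hZ⟩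
    obtain ⟨z, hz⟩ := exists_ball_pos Z
    have h1 : Tendsto (fun n => Delta2 (DSp n) Z ^ (2:ℝ) + ((n : ℝ≥0∞) + 1)⁻¹) atTop (𝓝 0) := by
      have := (((ENNReal.continuous_rpow_const (y := 2)).tendsto 0).comp hZ).add tendsto_inv_succ
      simpa using this
    have h2 := ge_of_tendsto' h1 (Delta2_DSp_lower Z z)
    simp at h2
    exact hz (by simpa using h2)

/-! ### Part (i) -/

/-- The disjoint union with the metric given by a metric coupling. -/
structure SumM {α β : Type} [MetricSpace α] [MetricSpace β] (D : α ⊕ β → α ⊕ β → ℝ)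
    (h : IsMetricCoupling D) where
  val : α ⊕ β

instance {α β : Type} [MetricSpace α] [MetricSpace β] (D : α ⊕ β → α ⊕ β → ℝ)
    (h : IsMetricCoupling D) : MetricSpace (SumM D h) where
  dist x y := D x.val y.val
  dist_self x := h.1 x.val
  dist_comm x y := h.2.1 x.val y.val
  dist_triangle x y z := h.2.2.1 x.val y.val z.val
  eq_of_dist_eq_zero {x y} hh := by
    have := h.2.2.2.1 x.val y.val hh
    cases x; cases y; simp_all

def SumM.l {α β : Type} [MetricSpace α] [MetricSpace β] {D : α ⊕ β → α ⊕ β → ℝ}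
    (h : IsMetricCoupling D) (x : α) : SumM D h := ⟨Sum.inl x⟩

def SumM.r {α β : Type} [MetricSpace α] [MetricSpace β] {D : α ⊕ β → α ⊕ β → ℝ}
    (h : IsMetricCoupling D) (x : β) : SumM D h := ⟨Sum.inr x⟩

theorem SumM.isom_l {α β : Type} [MetricSpace α] [MetricSpace β] {D : α ⊕ β → α ⊕ β → ℝ}
    (h : IsMetricCoupling D) : Isometry (SumM.l h) :=
  Isometry.of_dist_eq fun x y => h.2.2.2.2.1 x y

theorem SumM.isom_r {α β : Type} [MetricSpace α] [MetricSpace β] {D : α ⊕ β → α ⊕ β → ℝ}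
    (h : IsMetricCoupling D) : Isometry (SumM.r h) :=
  Isometry.of_dist_eq fun x y => h.2.2.2.2.2.1 x y

theorem SumM.dist_lr {α β : Type} [MetricSpace α] [MetricSpace β] {D : α ⊕ β → α ⊕ β → ℝ}
    (h : IsMetricCoupling D) (x : α) (y : β) :
    dist (SumM.l h x) (SumM.r h y) = D (Sum.inl x) (Sum.inr y) := rfl

/-- Auxiliary structure used to glue metric spaces successively. -/
structure AuxGl (A : Type) [MetricSpace A] : Type 1 where
  Space : Type
  metric : MetricSpace Space
  embed : A → Space
  isom : Isometry embed

attribute [instance] AuxGl.metric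

section Chain
variable (X S : ℕ → Type) [∀ n, MetricSpace (X n)] [∀ n, Nonempty (X n)]
  [∀ n, MetricSpace (S n)] (l : ∀ n, X n → S n) (r : ∀ n, X (n+1) → S n)
  (hl : ∀ n, Isometry (l n)) (hr : ∀ n, Isometry (r n))

def auxGl : (n : ℕ) → AuxGl (X n)
  | 0 => ⟨X 0, inferInstance, id, isometry_id⟩
  | n + 1 =>
    { Space := Metric.GlueSpace (auxGl n).isom (hl n)
      metric := inferInstance
      embed := Metric.toGlueR (auxGl n).isom (hl n) ∘ r n
      isom := (Metric.toGlueR_isometry _ _).comp (hr n) }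

def auxF (n : ℕ) : (auxGl X S l r hl hr n).Space → (auxGl X S l r hl hr (n+1)).Space :=
  Metric.toGlueL (auxGl X S l r hl hr n).isom (hl n)

theorem auxF_isom (n : ℕ) : Isometry (auxF X S l r hl hr n) :=
  Metric.toGlueL_isometry (auxGl X S l r hl hr n).isom (hl n)

theorem auxF_dist (n : ℕ) (x : X n) (y : X (n+1)) :
    dist (auxF X S l r hl hr n ((auxGl X S l r hl hr n).embed x))
      ((auxGl X S l r hl hr (n+1)).embed y) = dist (l n x) (r n y) := by
  have h := congrFun (Metric.toGlue_commute (auxGl X S l r hl hr n).isom (hl n)) x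
  simp only [Function.comp] at h
  unfold auxF
  rw [h]
  exact (Metric.toGlueR_isometry (auxGl X S l r hl hr n).isom (hl n)).dist_eq (l n x) (r n y)

theorem metric_chain0
    (hl : ∀ n, Isometry (l n)) (hr : ∀ n, Isometry (r n)) :
    ∃ (W : Type) (_ : MetricSpace W) (ι : ∀ n, X n → W),
    (∀ n, Isometry (ι n)) ∧ ∀ n x y, dist (ι n x) (ι (n+1) y) = dist (l n x) (r n y) := by
  refine ⟨Metric.InductiveLimit (auxF_isom X S l r hl hr), inferInstance,
    fun n x => Metric.toInductiveLimit (auxF_isom X S l r hl hr) n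
      ((auxGl X S l r hl hr n).embed x), fun n => ?_, fun n x y => ?_⟩
  · exact (Metric.toInductiveLimit_isometry _ n).comp (auxGl X S l r hl hr n).isom
  · have h := congrFun (Metric.toInductiveLimit_commute (auxF_isom X S l r hl hr) n)
      ((auxGl X S l r hl hr n).embed x)
    simp only [Function.comp] at h
    change dist (Metric.toInductiveLimit (auxF_isom X S l r hl hr) n
      ((auxGl X S l r hl hr n).embed x)) (Metric.toInductiveLimit (auxF_isom X S l r hl hr) (n+1)
      ((auxGl X S l r hl hr (n+1)).embed y)) = _
    rw [← h, (Metric.toInductiveLimit_isometry (auxF_isom X S l r hl hr) (n+1)).dist_eq]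
    exact auxF_dist X S l r hl hr n x y

theorem metric_chain [∀ n, TopologicalSpace.SeparableSpace (X n)]
    (hl : ∀ n, Isometry (l n)) (hr : ∀ n, Isometry (r n)) :
    ∃ (W : Type) (_ : MetricSpace W) (_ : CompleteSpace W)
    (_ : TopologicalSpace.SeparableSpace W) (ι : ∀ n, X n → W),
    (∀ n, Isometry (ι n)) ∧ ∀ n x y, dist (ι n x) (ι (n+1) y) = dist (l n x) (r n y) := by
  obtain ⟨W, mW, ι, hι, hd⟩ := metric_chain0 X S l r hl hr
  let ι' : ∀ n, X n → UniformSpace.Completion W := fun n x => (ι n x : UniformSpace.Completion W)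
  have hι' : ∀ n, Isometry (ι' n) := fun n => UniformSpace.Completion.coe_isometry.comp (hι n)
  let C : Set (UniformSpace.Completion W) := closure (⋃ n, range (ι' n))
  have hsep : TopologicalSpace.IsSeparable C := by
    refine TopologicalSpace.IsSeparable.closure (TopologicalSpace.IsSeparable.iUnion fun n => ?_)
    exact TopologicalSpace.isSeparable_range (hι' n).continuous
  have hmem : ∀ n x, ι' n x ∈ C := fun n x => subset_closure (mem_iUnion.2 ⟨n, mem_range_self x⟩)
  refine ⟨C, inferInstance, isClosed_closure.completeSpace_coe, hsep.separableSpace,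
    fun n x => ⟨ι' n x, hmem n x⟩, fun n => ?_, fun n x y => ?_⟩
  · exact Isometry.of_dist_eq fun x y => (hι' n).dist_eq x y
  · rw [← hd n x y]
    exact UniformSpace.Completion.coe_isometry.dist_eq (ι n x) (ι (n+1) y)
end Chain

theorem ennreal_sq_add_le (a b : ℝ≥0∞) : (a + b) ^ 2 ≤ 2 * a ^ 2 + 2 * b ^ 2 := by
  have := ENNReal.rpow_add_le_mul_rpow_add_rpow a b (p := 2) (by norm_num)
  norm_num at this
  rwa [mul_add] at this

/-- Gluing metric on the disjoint union. -/
def glD {α β W : Type} [MetricSpace α] [MetricSpace β] [MetricSpace W] (i : α → W) (j : β → W)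
    (ε : ℝ) : α ⊕ β → α ⊕ β → ℝ
  | Sum.inl x, Sum.inl y => dist x y
  | Sum.inr x, Sum.inr y => dist x y
  | Sum.inl x, Sum.inr y => dist (i x) (j y) + ε
  | Sum.inr y, Sum.inl x => dist (i x) (j y) + ε

theorem glD_coupling {α β W : Type} [MetricSpace α] [MetricSpace β] [MetricSpace W]
    [CompleteSpace α] [CompleteSpace β] [TopologicalSpace.SeparableSpace α]
    [TopologicalSpace.SeparableSpace β]
    {i : α → W} {j : β → W} (hi : Isometry i) (hj : Isometry j)
    {ε : ℝ} (hε : 0 < ε) : IsMetricCoupling (glD i j ε) := by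
  refine ⟨?_, ?_, ?_, ?_, fun _ _ => rfl, fun _ _ => rfl, ?_, ?_⟩
  · rintro (x | x) <;> simp [glD]
  · rintro (x | x) (y | y) <;> simp [glD, dist_comm]
  · rintro (x | x) (y | y) (z | z) <;> simp only [glD, ← hi.dist_eq, ← hj.dist_eq]
    · exact dist_triangle _ _ _
    · linarith [dist_triangle (i x) (i y) (j z)]
    · linarith [dist_triangle_right (i x) (i z) (j y)]
    · linarith [dist_triangle (i x) (j y) (j z)]
    · linarith [dist_triangle (i z) (i y) (j x), dist_comm (i y) (i z)]
    · linarith [dist_triangle_left (j x) (j z) (i y)]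
    · linarith [dist_triangle (i z) (j y) (j x), dist_comm (j y) (j x)]
    · exact dist_triangle _ _ _
  · rintro (x | x) (y | y) h <;> simp only [glD] at h
    · rw [eq_of_dist_eq_zero h]
    · linarith [dist_nonneg (x := i x) (y := j y)]
    · linarith [dist_nonneg (x := i y) (y := j x)]
    · rw [eq_of_dist_eq_zero h]
  · intro u hu
    obtain ⟨N, hN⟩ := hu ε hε
    rcases hx : u N with x | x
    · have h1 : ∀ k, ∃ v : α, u (k + N) = Sum.inl v := by
        intro k
        rcases hy : u (k + N) with y | y
        · exact ⟨y, rfl⟩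
        · have := hN N le_rfl (k + N) (by omega)
          rw [hx, hy] at this
          simp only [glD] at this
          linarith [dist_nonneg (x := i x) (y := j y)]
      choose v hv using h1
      have hc : CauchySeq v := by
        refine Metric.cauchySeq_iff.2 fun δ hδ => ?_
        obtain ⟨M, hM⟩ := hu δ hδ
        refine ⟨M, fun a ha b hb => ?_⟩
        have := hM (a + N) (by omega) (b + N) (by omega)
        rwa [hv, hv] at this
      obtain ⟨a, ha⟩ := cauchySeq_tendsto_of_complete hc
      refine ⟨Sum.inl a, (tendsto_add_atTop_iff_nat N).1 ?_⟩
      simp only [hv, glD]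
      exact tendsto_iff_dist_tendsto_zero.1 ha
    · have h1 : ∀ k, ∃ v : β, u (k + N) = Sum.inr v := by
        intro k
        rcases hy : u (k + N) with y | y
        · have := hN N le_rfl (k + N) (by omega)
          rw [hx, hy] at this
          simp only [glD] at this
          linarith [dist_nonneg (x := i y) (y := j x)]
        · exact ⟨y, rfl⟩
      choose v hv using h1
      have hc : CauchySeq v := by
        refine Metric.cauchySeq_iff.2 fun δ hδ => ?_
        obtain ⟨M, hM⟩ := hu δ hδ
        refine ⟨M, fun a ha b hb => ?_⟩
        have := hM (a + N) (by omega) (b + N) (by omega)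
        rwa [hv, hv] at this
      obtain ⟨a, ha⟩ := cauchySeq_tendsto_of_complete hc
      refine ⟨Sum.inr a, (tendsto_add_atTop_iff_nat N).1 ?_⟩
      simp only [hv, glD]
      exact tendsto_iff_dist_tendsto_zero.1 ha
  · obtain ⟨s, hs, hsd⟩ := TopologicalSpace.exists_countable_dense α
    obtain ⟨t, ht, htd⟩ := TopologicalSpace.exists_countable_dense β
    refine ⟨Sum.inl '' s ∪ Sum.inr '' t, (hs.image _).union (ht.image _), ?_⟩
    rintro (x | x) δ hδ
    · obtain ⟨y, hy, hxy⟩ := hsd.exists_dist_lt x hδ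
      exact ⟨Sum.inl y, Or.inl ⟨y, hy, rfl⟩, hxy⟩
    · obtain ⟨y, hy, hxy⟩ := htd.exists_dist_lt x hδ
      exact ⟨Sum.inr y, Or.inr ⟨y, hy, rfl⟩, hxy⟩

instance (Y : MM1) : SecondCountableTopology Y.carrier :=
  UniformSpace.secondCountable_of_separable _

instance (Y : MM1) : PolishSpace Y.carrier := inferInstance

instance (Y : MM1) : Nonempty Y.carrier := nonempty_of_isProbabilityMeasure Y.m

theorem IsCoupling.prob {α β : Type*} [MeasurableSpace α] [MeasurableSpace β]
    {q : Measure (α × β)} {μ : Measure α} {ν : Measure β} [IsProbabilityMeasure μ]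
    (h : IsCoupling q μ ν) : IsProbabilityMeasure q := by
  refine ⟨?_⟩
  have : Measure.map Prod.fst q univ = 1 := by rw [h.1]; simp
  rwa [Measure.map_apply measurable_fst MeasurableSet.univ] at this

theorem D2_sq_le (Y₀ Y₁ : MM1) {W : Type} [MetricSpace W] {i : Y₀.carrier → W}
    {j : Y₁.carrier → W} (hi : Isometry i) (hj : Isometry j)
    (q : Measure (Y₀.carrier × Y₁.carrier)) (hq : IsCoupling q Y₀.m Y₁.m) :
    D2 Y₀ Y₁ ^ 2 ≤ 2 * ∫⁻ p, edist (i p.1) (j p.2) ^ 2 ∂q := by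
  have := hq.prob
  refine ENNReal.le_of_forall_pos_le_add fun δ hδ _ => ?_
  have hε : 0 < Real.sqrt (δ / 2) := by positivity
  have h1 : D2 Y₀ Y₁ ≤ (∫⁻ p, ENNReal.ofReal
      (glD i j (Real.sqrt (δ / 2)) (Sum.inl p.1) (Sum.inr p.2)) ^ 2 ∂q) ^ (1/2 : ℝ) :=
    iInf₂_le_of_le q hq (iInf₂_le_of_le _ (glD_coupling hi hj hε) le_rfl)
  rw [one_div, ENNReal.le_rpow_inv_iff (by norm_num)] at h1
  rw [← ENNReal.rpow_two]
  refine h1.trans ?_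
  calc _ ≤ ∫⁻ p, (2 * edist (i p.1) (j p.2) ^ 2 + δ) ∂q := by
        refine lintegral_mono fun p => ?_
        simp only [glD]
        rw [ENNReal.ofReal_add dist_nonneg hε.le, ← edist_dist]
        refine (ennreal_sq_add_le _ _).trans ?_
        gcongr
        rw [← ENNReal.ofReal_pow (by positivity), Real.sq_sqrt (by positivity),
          ENNReal.ofReal_div_of_pos (by norm_num)]
        simp
        rw [ENNReal.mul_div_cancel (by norm_num) (by norm_num)]
    _ = _ := by
        rw [lintegral_add_right _ measurable_const, lintegral_const_mul' _ _ (by norm_num)]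
        simp

theorem D2_lt_exists {Y₀ Y₁ : MM1} {ε : ℝ≥0∞} (h : D2 Y₀ Y₁ < ε) :
    ∃ (q : Measure (Y₀.carrier × Y₁.carrier)) (_ : IsCoupling q Y₀.m Y₁.m)
      (D : Y₀.carrier ⊕ Y₁.carrier → Y₀.carrier ⊕ Y₁.carrier → ℝ) (hD : IsMetricCoupling D),
      ∫⁻ p, edist (SumM.l hD p.1) (SumM.r hD p.2) ^ 2 ∂q ≤ ε ^ 2 := by
  unfold D2 at h
  simp only [iInf_lt_iff] at h
  obtain ⟨q, hq, D, hD, hlt⟩ := h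
  refine ⟨q, hq, D, hD, ?_⟩
  rw [one_div, ENNReal.rpow_inv_lt_iff (by norm_num), ENNReal.rpow_two] at hlt
  simpa only [edist_dist, SumM.dist_lr] using hlt.le

theorem compProd_comap {A B C : Type*} [MeasurableSpace A] [MeasurableSpace B] [MeasurableSpace C]
    (μ : Measure A) [IsProbabilityMeasure μ] (κ : ProbabilityTheory.Kernel B C)
    [ProbabilityTheory.IsMarkovKernel κ] {g : A → B} (hg : Measurable g) :
    (μ.compProd (κ.comap g hg)).map (fun p => (g p.1, p.2)) = (μ.map g).compProd κ := by
  have hm : Measurable (fun p : A × C => (g p.1, p.2)) := by fun_prop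
  have : IsProbabilityMeasure (μ.map g) := Measure.isProbabilityMeasure_map hg.aemeasurable
  ext s hs
  rw [Measure.map_apply hm hs, Measure.compProd_apply (hm hs), Measure.compProd_apply hs,
    lintegral_map (ProbabilityTheory.Kernel.measurable_kernel_prodMk_left hs) hg]
  rfl

theorem glue_couplings {A B C : Type*} [MeasurableSpace A] [MeasurableSpace B] [MeasurableSpace C]
    [StandardBorelSpace C] [Nonempty C]
    {μ : Measure A} {ν : Measure B} {ξ : Measure C}
    [IsProbabilityMeasure μ] [IsProbabilityMeasure ν]
    {q : Measure (A × B)} {q' : Measure (B × C)} (h : IsCoupling q μ ν) (h' : IsCoupling q' ν ξ) :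
    ∃ P : Measure ((A × B) × C), P.map Prod.fst = q ∧ P.map (fun p => (p.1.2, p.2)) = q' := by
  have := h.prob
  have := h'.prob
  refine ⟨q.compProd (q'.condKernel.comap Prod.snd measurable_snd), ?_, ?_⟩
  · exact Measure.fst_compProd _ _
  · rw [compProd_comap, h.2, ← h'.1]
    exact q'.disintegrate _

theorem exists_glue {A B C : Type} [Nonempty C] [MetricSpace A] [MetricSpace B] [MetricSpace C]
    {f : C → A} {g : C → B} (hf : Isometry f) (hg : Isometry g) :
    ∃ (W : Type) (_ : MetricSpace W) (I : A → W) (J : B → W), Isometry I ∧ Isometry J ∧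
      ∀ y, I (f y) = J (g y) :=
  ⟨_, _, _, _, Metric.toGlueL_isometry hf hg, Metric.toGlueR_isometry hf hg,
    fun y => congrFun (Metric.toGlue_commute hf hg) y⟩

theorem D2_triangle {X Y Z : MM1} {a b : ℝ≥0∞} (h1 : D2 X Y < a) (h2 : D2 Y Z < b) :
    D2 X Z ^ 2 ≤ 4 * a ^ 2 + 4 * b ^ 2 := by
  obtain ⟨q, hq, D, hD, hle⟩ := D2_lt_exists h1
  obtain ⟨q', hq', D', hD', hle'⟩ := D2_lt_exists h2
  obtain ⟨P, hP, hP'⟩ := glue_couplings hq hq'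
  obtain ⟨W, _, I, J, hI, hJ, hIJ⟩ := exists_glue (SumM.isom_r hD) (SumM.isom_l hD')
  have hm : Measurable (fun p : (X.carrier × Y.carrier) × Z.carrier => (p.1.1, p.2)) := by fun_prop
  have hm2 : Measurable (fun p : (X.carrier × Y.carrier) × Z.carrier => (p.1.2, p.2)) := by fun_prop
  have hc : IsCoupling (P.map (fun p => (p.1.1, p.2))) X.m Z.m := by
    constructor
    · rw [Measure.map_map measurable_fst hm, ← hq.1, ← hP,
        Measure.map_map measurable_fst measurable_fst]
      rfl
    · rw [Measure.map_map measurable_snd hm, ← hq'.2, ← hP',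
        Measure.map_map measurable_snd hm2]
      rfl
  have ci : Continuous (fun x => I (SumM.l hD x)) := (hI.comp (SumM.isom_l hD)).continuous
  have cj : Continuous (fun x => J (SumM.r hD' x)) := (hJ.comp (SumM.isom_r hD')).continuous
  have cl : Continuous (SumM.l hD) := (SumM.isom_l hD).continuous
  have cr : Continuous (SumM.r hD) := (SumM.isom_r hD).continuous
  have cl' : Continuous (SumM.l hD') := (SumM.isom_l hD').continuous
  have cr' : Continuous (SumM.r hD') := (SumM.isom_r hD').continuous
  have m1 : Measurable fun p : X.carrier × Y.carrier =>
    edist (SumM.l hD p.1) (SumM.r hD p.2) ^ 2 := 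
    (((cl.comp continuous_fst).edist (cr.comp continuous_snd)).measurable).pow_const 2
  have m2 : Measurable fun p : Y.carrier × Z.carrier =>
    edist (SumM.l hD' p.1) (SumM.r hD' p.2) ^ 2 := 
    (((cl'.comp continuous_fst).edist (cr'.comp continuous_snd)).measurable).pow_const 2
  refine (D2_sq_le X Z (hI.comp (SumM.isom_l hD)) (hJ.comp (SumM.isom_r hD')) _ hc).trans ?_
  calc _ ≤ 2 * (2 * a ^ 2 + 2 * b ^ 2) := by
        gcongr
        change ∫⁻ p : X.carrier × Z.carrier, edist (I (SumM.l hD p.1)) (J (SumM.r hD' p.2)) ^ 2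
          ∂(P.map (fun p => (p.1.1, p.2))) ≤ _
        have m3 : Measurable fun p : X.carrier × Z.carrier =>
          edist (I (SumM.l hD p.1)) (J (SumM.r hD' p.2)) ^ 2 := (((ci.comp continuous_fst).edist
          (cj.comp continuous_snd)).measurable.pow_const 2)
        rw [lintegral_map m3 hm]
        calc _ ≤ ∫⁻ p, (2 * edist (SumM.l hD p.1.1) (SumM.r hD p.1.2) ^ 2 +
                2 * edist (SumM.l hD' p.1.2) (SumM.r hD' p.2) ^ 2) ∂P := by
              refine lintegral_mono fun p => ?_
              refine le_trans ?_ (ennreal_sq_add_le _ _)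
              gcongr
              rw [← hI.edist_eq, ← hJ.edist_eq, ← hIJ]
              exact edist_triangle _ _ _
          _ = 2 * ∫⁻ p, edist (SumM.l hD p.1) (SumM.r hD p.2) ^ 2 ∂q
              + 2 * ∫⁻ p, edist (SumM.l hD' p.1) (SumM.r hD' p.2) ^ 2 ∂q' := by
              rw [lintegral_add_left, lintegral_const_mul' _ _ (by norm_num),
                lintegral_const_mul' _ _ (by norm_num), ← hP, ← hP',
                lintegral_map m1 measurable_fst, lintegral_map m2 hm2]
              exact (m1.comp measurable_fst).const_mul 2
          _ ≤ _ := by gcongr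
    _ = _ := by ring

theorem markov_chain (Y : ℕ → MM1) (q : ∀ n, Measure ((Y n).carrier × (Y (n+1)).carrier))
    (hq : ∀ n, IsCoupling (q n) (Y n).m (Y (n+1)).m) :
    ∃ P : Measure (∀ n, (Y n).carrier), IsProbabilityMeasure P ∧
      ∀ n, P.map (fun w => (w n, w (n+1))) = q n := by
  have hp : ∀ n, IsProbabilityMeasure (q n) := fun n => (hq n).prob
  let g : ∀ n, (∀ i : Finset.Iic n, (Y i).carrier) → (Y n).carrier :=
    fun n w => w ⟨n, Finset.mem_Iic.2 le_rfl⟩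
  have hg : ∀ n, Measurable (g n) := fun n => measurable_pi_apply _
  let κ : ∀ n, ProbabilityTheory.Kernel (∀ i : Finset.Iic n, (Y i).carrier) (Y (n+1)).carrier :=
    fun n => (q n).condKernel.comap (g n) (hg n)
  have hκ : ∀ n, ProbabilityTheory.IsMarkovKernel (κ n) := fun n => by
    simp only [κ]; infer_instance
  let P := ProbabilityTheory.Kernel.trajMeasure (X := fun n => (Y n).carrier) (Y 0).m κ
  have hP : IsProbabilityMeasure P := by simp only [P]; infer_instance
  have step : ∀ n, P.map (fun w => (w n, w (n+1))) = (P.map (fun w => w n)).compProd (q n).condKernel := by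
    intro n
    have h1 := ProbabilityTheory.Kernel.map_frestrictLe_trajMeasure_compProd_eq_map_trajMeasure
      (X := fun n => (Y n).carrier) (μ₀ := (Y 0).m) (κ := κ) (a := n)
    have hfm : Measurable (Preorder.frestrictLe (π := fun n => (Y n).carrier) n) := by fun_prop
    have : IsProbabilityMeasure (P.map (Preorder.frestrictLe n)) :=
      Measure.isProbabilityMeasure_map hfm.aemeasurable
    have h2 := compProd_comap (P.map (Preorder.frestrictLe n)) (q n).condKernel (hg n)
    rw [Measure.map_map (hg n) hfm] at h2
    change _ = (P.map (fun w => w n)).compProd _ at h2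
    rw [← h2]
    change _ = Measure.map _ ((P.map (Preorder.frestrictLe n)).compProd (κ n))
    rw [h1, Measure.map_map]
    · rfl
    · exact ((hg n).comp measurable_fst).prodMk measurable_snd
    · exact hfm.prodMk (measurable_pi_apply _)
  have hpi : ∀ n, Measurable (fun w : (∀ n, (Y n).carrier) => (w n, w (n+1))) :=
    fun n => (measurable_pi_apply _).prodMk (measurable_pi_apply _)
  have marg : ∀ n, P.map (fun w => w n) = (Y n).m := by
    intro n
    induction n with
    | zero =>
      have hfm : Measurable (Preorder.frestrictLe (π := fun n => (Y n).carrier) 0) := by fun_prop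
      let e : (Y 0).carrier → (∀ i : Finset.Iic 0, (Y i).carrier) := (MeasurableEquiv.piUnique
          (fun i : Finset.Iic 0 => (Y i).carrier)).symm
      have he : Measurable e := MeasurableEquiv.measurable _
      have h1 : P.map (Preorder.frestrictLe 0) = (Y 0).m.map e := by
        simp only [P, ProbabilityTheory.Kernel.trajMeasure]
        rw [Measure.map_comp _ _ hfm, ProbabilityTheory.Kernel.traj_map_frestrictLe,
          ProbabilityTheory.Kernel.partialTraj_self, Measure.id_comp]
        rfl
      have h2 : P.map (fun w => w 0) = (P.map (Preorder.frestrictLe 0)).map (g 0) := by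
        rw [Measure.map_map (hg 0) hfm]; rfl
      rw [h2, h1, Measure.map_map (hg 0) he]
      exact Measure.map_id
    | succ n ih =>
      have h := step n
      rw [ih, ← (hq n).1] at h
      have h3 : (Measure.map Prod.fst (q n)).compProd (q n).condKernel = q n :=
        (q n).disintegrate _
      rw [h3] at h
      rw [← (hq n).2, ← h, Measure.map_map measurable_snd (hpi n)]
      rfl
  refine ⟨P, hP, fun n => ?_⟩
  rw [step n, marg n, ← (hq n).1]
  exact (q n).disintegrate _

theorem finiteSize_of_coupling (Y Z : MM1) {i : Y.carrier → Z.carrier} (hi : Isometry i)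
    (q : Measure (Y.carrier × Z.carrier)) (hq : IsCoupling q Y.m Z.m) (hY : FiniteSize Y)
    (hfin : ∫⁻ p, edist (i p.1) p.2 ^ 2 ∂q < ∞) : FiniteSize Z := by
  have := hq.prob
  unfold FiniteSize at *
  have mY : Measurable (fun p : Y.carrier × Y.carrier => edist p.1 p.2 ^ 2) := by fun_prop
  have mZ : Measurable (fun p : Z.carrier × Z.carrier => edist p.1 p.2 ^ 2) := by fun_prop
  have eY : (∫⁻ x, ∫⁻ y, edist x y ^ 2 ∂Y.m ∂Y.m)
      = ∫⁻ p, ∫⁻ p', edist p.1 p'.1 ^ 2 ∂q ∂q := by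
    have h1 : ∀ x, ∫⁻ y, edist x y ^ 2 ∂Y.m = ∫⁻ p', edist x p'.1 ^ 2 ∂q := by
      intro x
      rw [← hq.1, lintegral_map (by fun_prop) measurable_fst]
    have h2 : Measurable fun x => ∫⁻ y, edist x y ^ 2 ∂Y.m := mY.lintegral_prod_right'
    simp_rw [← h1]
    conv_lhs => rw [← hq.1]
    rw [lintegral_map (by rw [hq.1]; exact h2) measurable_fst, hq.1]
  have eZ : (∫⁻ x, ∫⁻ y, edist x y ^ 2 ∂Z.m ∂Z.m)
      = ∫⁻ p, ∫⁻ p', edist p.2 p'.2 ^ 2 ∂q ∂q := by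
    have h1 : ∀ x, ∫⁻ y, edist x y ^ 2 ∂Z.m = ∫⁻ p', edist x p'.2 ^ 2 ∂q := by
      intro x
      rw [← hq.2, lintegral_map (by fun_prop) measurable_snd]
    have h2 : Measurable fun x => ∫⁻ y, edist x y ^ 2 ∂Z.m := mZ.lintegral_prod_right'
    simp_rw [← h1]
    conv_lhs => rw [← hq.2]
    rw [lintegral_map (by rw [hq.2]; exact h2) measurable_snd, hq.2]
  rw [eZ]
  rw [eY] at hY
  have ci := hi.continuous.measurable
  have me : Measurable fun p : Y.carrier × Z.carrier => edist (i p.1) p.2 ^ 2 := by fun_prop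
  calc ∫⁻ p, ∫⁻ p', edist p.2 p'.2 ^ 2 ∂q ∂q
      ≤ ∫⁻ p, ∫⁻ p', (2 * edist (i p.1) p.2 ^ 2 + (4 * edist (i p'.1) p'.2 ^ 2 +
          4 * edist p.1 p'.1 ^ 2)) ∂q ∂q := by
        refine lintegral_mono fun p => lintegral_mono fun p' => ?_
        have h1 : edist p.2 p'.2 ≤ edist (i p.1) p.2 + (edist (i p'.1) p'.2 + edist p.1 p'.1) := by
          rw [← hi.edist_eq]
          calc edist p.2 p'.2 ≤ edist p.2 (i p.1) + edist (i p.1) (i p'.1) + edist (i p'.1) p'.2 :=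
                edist_triangle4 _ _ _ _
            _ = _ := by rw [edist_comm p.2]; ring
        calc edist p.2 p'.2 ^ 2 ≤ _ := pow_le_pow_left' h1 2
          _ ≤ _ := ennreal_sq_add_le _ _
          _ ≤ 2 * edist (i p.1) p.2 ^ 2 + 2 * (2 * edist (i p'.1) p'.2 ^ 2 +
              2 * edist p.1 p'.1 ^ 2) := by gcongr; exact ennreal_sq_add_le _ _
          _ = _ := by ring
    _ = ∫⁻ p, (2 * edist (i p.1) p.2 ^ 2 + (4 * ∫⁻ p', edist (i p'.1) p'.2 ^ 2 ∂q +
          4 * ∫⁻ p', edist p.1 p'.1 ^ 2 ∂q)) ∂q := by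
        refine lintegral_congr fun p => ?_
        rw [lintegral_add_left measurable_const, lintegral_add_left (me.const_mul 4),
          lintegral_const_mul' _ _ (by norm_num), lintegral_const_mul' _ _ (by norm_num),
          lintegral_const_mul' _ _ (by norm_num)]
        simp
    _ = 2 * ∫⁻ p, edist (i p.1) p.2 ^ 2 ∂q + (4 * ∫⁻ p', edist (i p'.1) p'.2 ^ 2 ∂q +
          4 * ∫⁻ p, ∫⁻ p', edist p.1 p'.1 ^ 2 ∂q ∂q) := by
        rw [lintegral_add_left (me.const_mul 2), lintegral_add_left measurable_const,
          lintegral_const_mul' _ _ (by norm_num), lintegral_const_mul' _ _ (by norm_num),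
          lintegral_const_mul' _ _ (by norm_num)]
        simp
    _ < ∞ := by
        simp only [ENNReal.add_lt_top]
        exact ⟨ENNReal.mul_lt_top (by norm_num) hfin, ENNReal.mul_lt_top (by norm_num) hfin,
          ENNReal.mul_lt_top (by norm_num) hY⟩

/-- Random variables with geometrically small consecutive `L²` distances converge. -/
theorem exists_limit {Ω W : Type} [MeasurableSpace Ω] (P : Measure Ω) [IsProbabilityMeasure P]
    [MetricSpace W] [CompleteSpace W] [SecondCountableTopology W] [MeasurableSpace W] [BorelSpace W]
    (x : ℕ → Ω → W) (hx : ∀ n, Measurable (x n))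
    (hd : ∀ n, ∫⁻ w, edist (x n w) (x (n+1) w) ^ 2 ∂P ≤ (1/4 : ℝ≥0∞) ^ n) :
    ∃ y : Ω → W, Measurable y ∧ ∀ n, ∫⁻ w, edist (x n w) (y w) ^ 2 ∂P ≤ 4 * (1/4 : ℝ≥0∞) ^ n := by
  have med : ∀ a b, Measurable fun w => edist (x a w) (x b w) := fun a b => (hx a).edist (hx b)
  have h2pow : ∀ n : ℕ, (2:ℝ≥0∞) ^ n * (1/4) ^ n = (1/2) ^ n := by
    intro n
    rw [← mul_pow]
    congr 1
    rw [one_div, one_div, show (4:ℝ≥0∞) = 2 * 2 by norm_num,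
      ENNReal.mul_inv (by norm_num) (by norm_num), ← mul_assoc,
      ENNReal.mul_inv_cancel (by norm_num) (by norm_num), one_mul]
  have hsum : ∀ᵐ w ∂P, ∑' n, edist (x n w) (x (n+1) w) < ∞ := by
    refine ae_lt_top (Measurable.tsum fun n => med n (n+1)) ?_
    rw [lintegral_tsum fun n => (med n (n+1)).aemeasurable]
    refine ne_top_of_le_ne_top ?_ (ENNReal.tsum_le_tsum (g := fun n => 2 * (1/2 : ℝ≥0∞) ^ n)
      fun n => ?_)
    · rw [ENNReal.tsum_mul_left, ENNReal.tsum_geometric, one_div, ENNReal.one_sub_inv_two, inv_inv]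
      norm_num
    · calc ∫⁻ w, edist (x n w) (x (n+1) w) ∂P
          ≤ ∫⁻ w, ((1/2) ^ n + 2 ^ n * edist (x n w) (x (n+1) w) ^ 2) ∂P := by
            refine lintegral_mono fun w => ?_
            have hone : (2:ℝ≥0∞) ^ n * (1/2) ^ n = 1 := by
              rw [← mul_pow, one_div, ENNReal.mul_inv_cancel (by norm_num) (by norm_num), one_pow]
            set d := edist (x n w) (x (n+1) w)
            rcases le_total d ((1/2)^n) with h | h
            · exact h.trans le_self_add
            · refine le_trans ?_ le_add_self
              calc d = (2 ^ n * (1/2) ^ n) * d := by rw [hone, one_mul]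
                _ ≤ (2 ^ n * d) * d := by gcongr
                _ = _ := by ring
        _ ≤ _ := by
            rw [lintegral_add_left measurable_const, lintegral_const_mul' _ _ (by simp)]
            calc _ ≤ (1/2 : ℝ≥0∞) ^ n + 2 ^ n * (1/4) ^ n := by
                  gcongr
                  · simp
                  · exact hd n
              _ = _ := by rw [h2pow]; ring
  have hlim : ∀ᵐ w ∂P, ∃ l, Tendsto (fun n => x n w) atTop (𝓝 l) := by
    filter_upwards [hsum] with w hw
    exact cauchySeq_tendsto_of_complete
      (cauchySeq_of_edist_le_of_tsum_ne_top _ (fun n => le_rfl) hw.ne)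
  obtain ⟨y, hy, hty⟩ := measurable_limit_of_tendsto_metrizable_ae
    (fun n => (hx n).aemeasurable) hlim
  refine ⟨y, hy, fun n => ?_⟩
  have bound : ∀ l n, ∫⁻ w, edist (x n w) (x (n + l) w) ^ 2 ∂P ≤ 4 * (1/4 : ℝ≥0∞) ^ n := by
    intro l
    induction l with
    | zero => intro n; simp
    | succ l ih =>
      intro n
      calc ∫⁻ w, edist (x n w) (x (n + (l+1)) w) ^ 2 ∂P
          ≤ ∫⁻ w, (2 * edist (x n w) (x (n+1) w) ^ 2 +
              2 * edist (x (n+1) w) (x (n + 1 + l) w) ^ 2) ∂P := by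
            refine lintegral_mono fun w => ?_
            refine le_trans ?_ (ennreal_sq_add_le _ _)
            rw [show n + (l + 1) = n + 1 + l by ring]
            gcongr
            exact edist_triangle _ _ _
        _ = 2 * ∫⁻ w, edist (x n w) (x (n+1) w) ^ 2 ∂P +
              2 * ∫⁻ w, edist (x (n+1) w) (x (n + 1 + l) w) ^ 2 ∂P := by
            rw [lintegral_add_left (((med _ _).pow_const 2).const_mul 2),
              lintegral_const_mul' _ _ (by norm_num), lintegral_const_mul' _ _ (by norm_num)]
        _ ≤ 2 * (1/4 : ℝ≥0∞) ^ n + 2 * (4 * (1/4 : ℝ≥0∞) ^ (n+1)) := by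
            gcongr
            · exact hd n
            · exact ih (n+1)
        _ = 2 * (1/4 : ℝ≥0∞) ^ n + 2 * ((4 * (1/4 : ℝ≥0∞)) * (1/4) ^ n) := by ring
        _ = _ := by
            rw [one_div, ENNReal.mul_inv_cancel (by norm_num) (by norm_num)]; ring
  calc ∫⁻ w, edist (x n w) (y w) ^ 2 ∂P
      = ∫⁻ w, liminf (fun l => edist (x n w) (x (n + l) w) ^ 2) atTop ∂P := by
        refine lintegral_congr_ae ?_
        filter_upwards [hty] with w hw
        have h1 : Tendsto (fun l => x (n + l) w) atTop (𝓝 (y w)) := by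
          simpa [add_comm] using (tendsto_add_atTop_iff_nat n).2 hw
        have h2 : Tendsto (fun l => edist (x n w) (x (n + l) w) ^ 2) atTop
            (𝓝 (edist (x n w) (y w) ^ 2)) :=
          ((ENNReal.continuous_pow 2).tendsto _).comp (tendsto_const_nhds.edist h1)
        exact h2.liminf_eq.symm
    _ ≤ liminf (fun l => ∫⁻ w, edist (x n w) (x (n + l) w) ^ 2 ∂P) atTop :=
        lintegral_liminf_le fun l => (med _ _).pow_const 2
    _ ≤ liminf (fun _ : ℕ => 4 * (1/4 : ℝ≥0∞) ^ n) atTop :=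
        liminf_le_liminf (Eventually.of_forall fun l => bound l n)
    _ = _ := by simp

/-- Completeness along a fast Cauchy sequence. -/
theorem fast_limit (Y : ℕ → MM1) (h0 : FiniteSize (Y 0))
    (hY : ∀ n, D2 (Y n) (Y (n+1)) < (1/2 : ℝ≥0∞) ^ n) :
    ∃ Z : MM1, FiniteSize Z ∧ ∀ n, D2 (Y n) Z ^ 2 ≤ 8 * (1/4 : ℝ≥0∞) ^ n := by
  choose q hq D hD hle using fun n => D2_lt_exists (hY n)
  obtain ⟨W, mW, cW, sW, ι, hι, hιd⟩ := metric_chain (fun n => (Y n).carrier)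
    (fun n => SumM (D n) (hD n)) (fun n => SumM.l (hD n)) (fun n => SumM.r (hD n))
    (fun n => SumM.isom_l (hD n)) (fun n => SumM.isom_r (hD n))
  obtain ⟨P, hP, hPq⟩ := markov_chain Y q hq
  letI : MeasurableSpace W := borel W
  have bW : BorelSpace W := ⟨rfl⟩
  have scW : SecondCountableTopology W := UniformSpace.secondCountable_of_separable _
  let x : ℕ → (∀ n, (Y n).carrier) → W := fun n w => ι n (w n)
  have hpi : ∀ n, Measurable (fun w : (∀ n, (Y n).carrier) => w n) := fun n => measurable_pi_apply n
  have hx : ∀ n, Measurable (x n) := fun n => (hι n).continuous.measurable.comp (hpi n)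
  have hmarg : ∀ n, P.map (fun w => w n) = (Y n).m := by
    intro n
    rw [← (hq n).1, ← hPq n, Measure.map_map measurable_fst ((hpi n).prodMk (hpi (n+1)))]
    rfl
  have hd : ∀ n, ∫⁻ w, edist (x n w) (x (n+1) w) ^ 2 ∂P ≤ (1/4 : ℝ≥0∞) ^ n := by
    intro n
    have m1 : Measurable fun p : (Y n).carrier × (Y (n+1)).carrier =>
      edist (ι n p.1) (ι (n+1) p.2) ^ 2 :=
      (((hι n).continuous.comp continuous_fst).edist
        ((hι (n+1)).continuous.comp continuous_snd)).measurable.pow_const 2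
    have e1 : ∫⁻ w, edist (x n w) (x (n+1) w) ^ 2 ∂P
        = ∫⁻ p, edist (ι n p.1) (ι (n+1) p.2) ^ 2 ∂(q n) := by
      rw [← hPq n, lintegral_map m1 ((hpi n).prodMk (hpi (n+1)))]
    rw [e1]
    have e2 := hle n
    simp only [edist_dist] at e2 ⊢
    simp only [hιd]
    refine e2.trans (le_of_eq ?_)
    rw [← pow_mul, mul_comm n 2, pow_mul]
    congr 1
    rw [one_div, one_div, ← ENNReal.inv_pow]
    norm_num
  obtain ⟨y, hy, hyb⟩ := exists_limit P x hx hd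
  have pz : IsProbabilityMeasure (P.map y) := Measure.isProbabilityMeasure_map hy.aemeasurable
  let Z : MM1 := ⟨W, mW, cW, sW, borel W, bW, P.map y, pz⟩
  let Q : ∀ n, Measure ((Y n).carrier × Z.carrier) := fun n => P.map (fun w => (w n, y w))
  have hmQ : ∀ n, Measurable (fun w : (∀ n, (Y n).carrier) => (w n, y w)) :=
    fun n => (hpi n).prodMk hy
  have hQ : ∀ n, IsCoupling (Q n) (Y n).m Z.m := by
    intro n
    constructor
    · rw [← hmarg n]
      exact Measure.map_map measurable_fst (hmQ n)
    · exact Measure.map_map measurable_snd (hmQ n)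
  have hQb : ∀ n, ∫⁻ p, edist (ι n p.1) p.2 ^ 2 ∂(Q n) ≤ 4 * (1/4 : ℝ≥0∞) ^ n := by
    intro n
    refine le_trans (le_of_eq ?_) (hyb n)
    have m1 : Measurable fun p : (Y n).carrier × W => edist (ι n p.1) p.2 ^ 2 :=
      (((hι n).continuous.comp continuous_fst).edist continuous_snd).measurable.pow_const 2
    exact lintegral_map m1 (hmQ n)
  refine ⟨Z, ?_, fun n => ?_⟩
  · refine finiteSize_of_coupling (Y 0) Z (i := ι 0) (hι 0) (Q 0) (hQ 0) h0 ?_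
    exact (hQb 0).trans_lt (by norm_num)
  · refine (D2_sq_le (Y n) Z (i := ι n) (j := (id : W → W)) (hι n) isometry_id (Q n) (hQ n)).trans ?_
    calc _ ≤ 2 * (4 * (1/4 : ℝ≥0∞) ^ n) := by gcongr; exact hQb n
      _ = _ := by ring

theorem part_one (Y : ℕ → MM1) (hf : ∀ n, FiniteSize (Y n)) (hc : IsCauchySeqWith D2 Y) :
      ∃ Z : MM1, FiniteSize Z ∧
        Filter.Tendsto (fun n => D2 (Y n) Z) Filter.atTop (nhds 0) := by
  have hpos : ∀ k : ℕ, (0 : ℝ≥0∞) < (1/2) ^ k := fun k => ENNReal.pow_pos (by norm_num) k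
  obtain ⟨φ, hφ, hφN⟩ := extraction_forall_of_eventually'
    (P := fun k N => ∀ j ≥ N, ∀ l ≥ N, D2 (Y j) (Y l) < (1/2 : ℝ≥0∞) ^ k) (fun k => by
      obtain ⟨N, hN⟩ := hc _ (hpos k)
      exact ⟨N, fun M hM j hj l hl => hN j (hM.trans hj) l (hM.trans hl)⟩)
  obtain ⟨Z, hZ, hZb⟩ := fast_limit (fun k => Y (φ k)) (hf _)
    (fun k => hφN k _ le_rfl _ (hφ (Nat.lt_succ_self k)).le)
  refine ⟨Z, hZ, ?_⟩
  have hlim : Tendsto (fun k : ℕ => 4 * ((1/2 : ℝ≥0∞) ^ k) ^ 2 + 4 * (9 * (1/4 : ℝ≥0∞) ^ k))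
      atTop (𝓝 0) := by
    have a1 : Tendsto (fun k : ℕ => (1/2 : ℝ≥0∞) ^ k) atTop (𝓝 0) :=
      ENNReal.tendsto_pow_atTop_nhds_zero_of_lt_one (by norm_num)
    have a2 : Tendsto (fun k : ℕ => (1/4 : ℝ≥0∞) ^ k) atTop (𝓝 0) :=
      ENNReal.tendsto_pow_atTop_nhds_zero_of_lt_one (by norm_num)
    have a3 : Tendsto (fun k : ℕ => ((1/2 : ℝ≥0∞) ^ k) ^ 2) atTop (𝓝 0) := by
      simpa [Function.comp_def] using ((ENNReal.continuous_pow 2).tendsto 0).comp a1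
    have b1 := ENNReal.Tendsto.const_mul (a := 4) a3 (Or.inr (by norm_num))
    have b2 := ENNReal.Tendsto.const_mul (a := 4)
      (ENNReal.Tendsto.const_mul (a := 9) a2 (Or.inr (by norm_num))) (Or.inr (by norm_num))
    simpa using b1.add b2
  refine ENNReal.tendsto_nhds_zero.2 fun ε hε => ?_
  have hε2 : (0 : ℝ≥0∞) < ε ^ 2 := ENNReal.pow_pos hε 2
  obtain ⟨k, hk⟩ := (hlim.eventually (gt_mem_nhds hε2)).exists
  filter_upwards [eventually_ge_atTop (φ k)] with n hn
  have h1 := hφN k n hn (φ k) le_rfl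
  have h2 : D2 (Y (φ k)) Z < (9 * (1/4 : ℝ≥0∞) ^ k) ^ (1/2 : ℝ) := by
    rw [one_div (2:ℝ), ENNReal.lt_rpow_inv_iff (by norm_num), ENNReal.rpow_two]
    refine (hZb k).trans_lt ?_
    refine ENNReal.mul_lt_mul_left ?_ ?_ (by norm_num)
    · exact (ENNReal.pow_pos (by norm_num) k).ne'
    · exact ENNReal.pow_ne_top (by norm_num)
  have h3 := D2_triangle h1 h2
  have h4 : ((9 * (1/4 : ℝ≥0∞) ^ k) ^ (1/2 : ℝ)) ^ 2 = 9 * (1/4 : ℝ≥0∞) ^ k := by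
    rw [← ENNReal.rpow_two, ← ENNReal.rpow_mul]; norm_num
  rw [h4] at h3
  have h5 := h3.trans hk.le
  rw [← ENNReal.rpow_two, ← ENNReal.rpow_two] at h5
  exact (ENNReal.rpow_le_rpow_iff (by norm_num)).1 h5

/-- **(i) `D₂` is complete on mm₁-spaces of finite size, whereas (ii) `Δ₂` is not.** -/
theorem D2_complete_Delta2_not_complete :
    (∀ Y : ℕ → MM1, (∀ n, FiniteSize (Y n)) → IsCauchySeqWith D2 Y →
      ∃ Z : MM1, FiniteSize Z ∧
        Filter.Tendsto (fun n => D2 (Y n) Z) Filter.atTop (nhds 0)) ∧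
    (∃ Y : ℕ → MM1, (∀ n, FiniteSize (Y n)) ∧ IsCauchySeqWith Delta2 Y ∧
      ¬ ∃ Z : MM1, Filter.Tendsto (fun n => Delta2 (Y n) Z) Filter.atTop (nhds 0)) := by
  exact ⟨part_one, part_two⟩

end
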